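/- Let Δ be a simplicial complex on {1,…,r} with facets F_1,…,F_t, and suppose there exist n ≥ 1, i ≥ 0 and α ∈ ℕ^r with H_m^i(R/I_Δ^{(n)})_α ≠ 0 and (after renumbering) F(Δ_α(I_Δ^{(n)})) = {F_1,…,F_s}, where 1 ≤ s ≤ t. Let C_1 ⊆ ℝ^r be the polytope defined by ∑_{i∉F_j} x_i ≤ 1 for j = 1,…,s, ∑_{i∉F_j} x_i ≥ 1 for j = s+1,…,t, and x ≥ 0. Then δ(C_1) ≤ δ(I_Δ), where δ(C_1) = max{x_1+⋯+x_r : x ∈ C_1}. -/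

import Mathlib

open MvPolynomial Finset Filter

noncomputable section

/-- A family of potential faces (subsets of the vertex set `ι`). -/
abbrev FaceSet (ι : Type*) := Set (Finset ι)

/-- A face set is a simplicial complex if it is closed under taking subsets. -/
def IsSimplicialComplex {ι : Type*} (Δ : FaceSet ι) : Prop :=
  ∀ σ ∈ Δ, ∀ τ : Finset ι, τ ⊆ σ → τ ∈ Δ

/-- The facets (maximal faces) of a face set. -/
def facets {ι : Type*} (Δ : FaceSet ι) : FaceSet ι :=
  {σ | σ ∈ Δ ∧ ∀ τ ∈ Δ, σ ⊆ τ → σ = τ}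

/-- The Stanley–Reisner ideal of a simplicial complex: it is generated by the
square-free monomials corresponding to non-faces. -/
def srIdeal (K : Type*) [Field K] {ι : Type*} (Δ : FaceSet ι) :
    Ideal (MvPolynomial ι K) :=
  Ideal.span {p | ∃ τ : Finset ι, τ ∉ Δ ∧ p = ∏ i ∈ τ, X i}

/-- The `n`-th symbolic power `I^{(n)} = ⋂_{p ∈ Min(I)} (Iⁿ R_p ∩ R)`. -/
def symbolicPower {R : Type*} [CommRing R] (I : Ideal R) (n : ℕ) : Ideal R :=
  ⨅ (p : Ideal R) (hp : p ∈ I.minimalPrimes),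
    letI : p.IsPrime := hp.1.1
    (Ideal.map (algebraMap R (Localization.AtPrime p)) (I ^ n)).comap
      (algebraMap R (Localization.AtPrime p))

/-- The simplicial boundary operator on the space of chains (finitely supported
`K`-valued functions on finite subsets of `ι`), using the orientation coming
from the linear order of `ι`; a set of cardinality `d` is viewed as a
`(d-1)`-dimensional simplex, the empty set accounting for the augmentation. -/
def bdry (K : Type*) [Field K] {ι : Type*} [LinearOrder ι] :
    (Finset ι →₀ K) →ₗ[K] (Finset ι →₀ K) :=
  Finsupp.lsum K fun σ => LinearMap.toSpanSingleton K _
    (∑ v ∈ σ, ((-1 : K) ^ (σ.filter fun w => w < v).card) • Finsupp.single (σ.erase v) (1 : K))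

/-- The subspace of chains supported on the faces of `Δ` of cardinality `d`. -/
def cardFaces (K : Type*) [Field K] {ι : Type*} (Δ : FaceSet ι) (d : ℕ) :
    Submodule K (Finset ι →₀ K) :=
  Submodule.span K {f | ∃ σ ∈ Δ, σ.card = d ∧ f = Finsupp.single σ (1 : K)}

/-- `H̃ⱼ(Δ; K) ≠ 0`: there is a cycle of cardinality-degree `j + 1` which is not
a boundary of a chain of `Δ`. -/
def HasNontrivialReducedHomology (K : Type*) [Field K] {ι : Type*} [LinearOrder ι]
    (Δ : FaceSet ι) (j : ℤ) : Prop :=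
  ∃ d : ℕ, (d : ℤ) = j + 1 ∧
    ∃ z ∈ cardFaces K Δ d, bdry K z = 0 ∧ z ∉ ⇑(bdry K) '' ↑(cardFaces K Δ (d + 1))

/-- `G_α = {i : α_i < 0}`. -/
def negSupport {ι : Type*} [Fintype ι] (α : ι → ℤ) : Finset ι :=
  Finset.univ.filter fun i => α i < 0

/-- The degree complex `Δ_α(I) = {F ⊆ [r] \ G_α : x^α ∉ I·R_F}` of Takayama, where
`x^α ∈ I·R_F` is expressed by saturation: `x^{α⁺}·(∏_{i ∈ F ∪ G_α} x_i)^m ∈ I` for some `m`. -/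
def degreeComplex (K : Type*) [Field K] {ι : Type*} [Fintype ι] [LinearOrder ι]
    (I : Ideal (MvPolynomial ι K)) (α : ι → ℤ) : FaceSet ι :=
  {F | (∀ i ∈ F, 0 ≤ α i) ∧
    ¬∃ m : ℕ,
      monomial (Finsupp.equivFunOnFinite.symm fun i => (α i).toNat) (1 : K) *
        (∏ i ∈ F ∪ negSupport α, X i) ^ m ∈ I}

/-- Nonvanishing of the graded piece `H_𝔪^i(R/I)_α` of local cohomology of a monomial
quotient, expressed via Takayama's formula
`dim_K H_𝔪^i(R/I)_α = dim_K H̃_{i-|G_α|-1}(Δ_α(I); K)`. -/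
def lcNonzero (K : Type*) [Field K] {ι : Type*} [Fintype ι] [LinearOrder ι]
    (I : Ideal (MvPolynomial ι K)) (i : ℕ) (α : ι → ℤ) : Prop :=
  HasNontrivialReducedHomology K (degreeComplex K I α) ((i : ℤ) - (negSupport α).card - 1)

/-- The `a_i`-invariant `a_i(R/I) = max{t : H_𝔪^i(R/I)_t ≠ 0}` of a monomial quotient
(`H_𝔪^i(R/I)_t = ⊕_{|α| = t} H_𝔪^i(R/I)_α`). -/
def aInv (K : Type*) [Field K] {ι : Type*} [Fintype ι] [LinearOrder ι]
    (I : Ideal (MvPolynomial ι K)) (i : ℕ) : ℤ :=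
  sSup {z : ℤ | ∃ α : ι → ℤ, lcNonzero K I i α ∧ z = ∑ j, α j}

/-- The Castelnuovo–Mumford regularity `reg(R/I) = max_i (a_i(R/I) + i)` of a
monomial quotient. -/
def regQuot (K : Type*) [Field K] {ι : Type*} [Fintype ι] [LinearOrder ι]
    (I : Ideal (MvPolynomial ι K)) : ℤ :=
  sSup {z : ℤ | ∃ (i : ℕ) (α : ι → ℤ), lcNonzero K I i α ∧ z = (∑ j, α j) + i}

/-- The Castelnuovo–Mumford regularity of a (monomial) ideal: `reg(I) = reg(R/I) + 1`. -/
def reg (K : Type*) [Field K] {ι : Type*} [Fintype ι] [LinearOrder ι]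
    (I : Ideal (MvPolynomial ι K)) : ℤ :=
  regQuot K I + 1

/-- The depth `min{i : H_𝔪^i(R/I) ≠ 0}` of a monomial quotient. -/
def depthQuot (K : Type*) [Field K] {ι : Type*} [Fintype ι] [LinearOrder ι]
    (I : Ideal (MvPolynomial ι K)) : ℕ :=
  sInf {i : ℕ | ∃ α : ι → ℤ, lcNonzero K I i α}

/-- The projective dimension `pd(R/I) = r - depth(R/I)` (Auslander–Buchsbaum). -/
def pdQuot (K : Type*) [Field K] {ι : Type*} [Fintype ι] [LinearOrder ι]
    (I : Ideal (MvPolynomial ι K)) : ℤ :=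
  (Fintype.card ι : ℤ) - depthQuot K I

end
/-- The polyhedron in `ℝ^r` given by `∑_{i ∉ F_j} x_i ≤ m` for `j < s`,
`∑_{i ∉ F_j} x_i ≥ m` for `s ≤ j < t`, and `x ≥ 0`. -/
def polyC {r t : ℕ} (F : Fin t → Finset (Fin r)) (s : ℕ) (m : ℝ) : Set (Fin r → ℝ) :=
  {x | (∀ i, 0 ≤ x i) ∧ ∀ j : Fin t,
    ((j : ℕ) < s → ∑ i ∈ (F j)ᶜ, x i ≤ m) ∧ (s ≤ (j : ℕ) → m ≤ ∑ i ∈ (F j)ᶜ, x i)}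

section CoordinatePrimes

variable (K : Type*) [Field K] {ι : Type*}

/-- The prime `P_F = (x_i : i ∉ F)`. -/
noncomputable def facePrime (F : Finset ι) : Ideal (MvPolynomial ι K) :=
  Ideal.span (X '' {i | i ∉ F})

lemma X_mem_facePrime {F : Finset ι} {i : ι} :
    (X i : MvPolynomial ι K) ∈ facePrime K F ↔ i ∉ F := by
  classical
  rw [facePrime, mem_ideal_span_X_image]
  simp only [support_X, Finset.mem_singleton, forall_eq, Set.mem_ofPred_eq]
  constructor
  · rintro ⟨j, hj, h⟩
    have : i = j := by
      by_contra hne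
      exact h (Finsupp.single_eq_of_ne (Ne.symm hne))
    exact this ▸ hj
  · intro h
    exact ⟨i, h, by simp⟩

lemma facePrime_isPrime (F : Finset ι) : (facePrime K F).IsPrime := by
  classical
  let φ : MvPolynomial ι K →ₐ[K] MvPolynomial ι K :=
    aeval fun i => if i ∈ F then X i else 0
  have hsub (f : MvPolynomial ι K) : f - φ f ∈ facePrime K F := by
    rw [← Ideal.Quotient.eq]
    have : (Ideal.Quotient.mkₐ K (facePrime K F)).comp φ
        = Ideal.Quotient.mkₐ K (facePrime K F) := by
      ext i
      by_cases hi : i ∈ F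
      · simp [φ, hi]
      · simpa [φ, hi] using
          ((Ideal.Quotient.eq_zero_iff_mem).2 ((X_mem_facePrime K).2 hi)).symm
    exact (DFunLike.congr_fun this f).symm
  have hker : facePrime K F = RingHom.ker φ := by
    apply le_antisymm
    · rw [facePrime, Ideal.span_le]
      rintro _ ⟨i, hi, rfl⟩
      have hi' : i ∉ F := hi
      simp [φ, hi', RingHom.mem_ker]
    · intro f hf
      have := hsub f
      rwa [(RingHom.mem_ker).1 hf, sub_zero] at this
  rw [hker]
  exact RingHom.ker_isPrime _

lemma srIdeal_le_iff {Δ : FaceSet ι} {J : Ideal (MvPolynomial ι K)} :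
    srIdeal K Δ ≤ J ↔ ∀ τ : Finset ι, τ ∉ Δ → ∏ i ∈ τ, (X i : MvPolynomial ι K) ∈ J := by
  rw [srIdeal, Ideal.span_le]
  constructor
  · intro h τ hτ
    exact h ⟨τ, hτ, rfl⟩
  · rintro h _ ⟨τ, hτ, rfl⟩
    exact h τ hτ

lemma srIdeal_le_facePrime {Δ : FaceSet ι} (hΔ : IsSimplicialComplex Δ) {F : Finset ι}
    (hF : F ∈ Δ) : srIdeal K Δ ≤ facePrime K F := by
  rw [srIdeal_le_iff]
  intro τ hτ
  have : ¬ τ ⊆ F := fun h => hτ (hΔ F hF τ h)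
  obtain ⟨i, hi, hiF⟩ := Finset.not_subset.1 this
  exact Ideal.mem_of_dvd _ (Finset.dvd_prod_of_mem _ hi) ((X_mem_facePrime K).2 hiF)

lemma exists_facet_superset [Finite ι] {Δ : FaceSet ι} {σ : Finset ι} (hσ : σ ∈ Δ) :
    ∃ F ∈ facets Δ, σ ⊆ F := by
  have hfin : (Δ : Set (Finset ι)).Finite := Set.toFinite _
  obtain ⟨F, hle, hmax⟩ := hfin.exists_le_maximal hσ
  exact ⟨F, ⟨hmax.1, fun τ hτ h => le_antisymm h (hmax.2 hτ h)⟩, hle⟩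

lemma exists_face_X_notMem [Fintype ι] {Δ : FaceSet ι} {p : Ideal (MvPolynomial ι K)}
    (hp : p.IsPrime) (hle : srIdeal K Δ ≤ p) :
    ∃ τ ∈ Δ, ∀ i, i ∈ τ ↔ (X i : MvPolynomial ι K) ∉ p := by
  classical
  refine ⟨Finset.univ.filter fun i => (X i : MvPolynomial ι K) ∉ p, ?_, by simp⟩
  by_contra hτ
  obtain ⟨i, hi, hip⟩ := (hp.prod_mem_iff).1 ((srIdeal_le_iff K).1 hle _ hτ)
  exact (Finset.mem_filter.1 hi).2 hip

lemma mem_minimalPrimes_srIdeal [Fintype ι] {Δ : FaceSet ι} (hΔ : IsSimplicialComplex Δ)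
    (p : Ideal (MvPolynomial ι K)) :
    p ∈ (srIdeal K Δ).minimalPrimes ↔ ∃ F ∈ facets Δ, p = facePrime K F := by
  have key {q : Ideal (MvPolynomial ι K)} {τ G : Finset ι}
      (hτ : ∀ i, i ∈ τ ↔ (X i : MvPolynomial ι K) ∉ q) (h : τ ⊆ G) : facePrime K G ≤ q := by
    rw [facePrime, Ideal.span_le]
    rintro _ ⟨i, hi, rfl⟩
    by_contra hq
    exact hi (h ((hτ i).2 hq))
  constructor
  · intro hp
    obtain ⟨τ, hτΔ, hτ⟩ := exists_face_X_notMem K hp.1.1 hp.1.2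
    obtain ⟨F, hF, hτF⟩ := exists_facet_superset hτΔ
    have hle := key hτ hτF
    exact ⟨F, hF, le_antisymm
      (hp.2 ⟨facePrime_isPrime K F, srIdeal_le_facePrime K hΔ hF.1⟩ hle) hle⟩
  · rintro ⟨F, hF, rfl⟩
    refine ⟨⟨facePrime_isPrime K F, srIdeal_le_facePrime K hΔ hF.1⟩, ?_⟩
    rintro q ⟨hq, hqI⟩ hqle
    obtain ⟨τ, hτΔ, hτ⟩ := exists_face_X_notMem K hq hqI
    have hFτ : F ⊆ τ := fun i hi => (hτ i).2 fun h => (X_mem_facePrime K).1 (hqle h) hi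
    exact key hτ (hF.2 τ hτΔ hFτ).ge

end CoordinatePrimes

section SymbolicPowers

variable (K : Type*) [Field K] {ι : Type*} [Fintype ι] [DecidableEq ι]

lemma le_sum_compl_of_mem_srIdeal_pow {Δ : FaceSet ι} (hΔ : IsSimplicialComplex Δ)
    {F : Finset ι} (hF : F ∈ Δ) (m : ℕ) {f : MvPolynomial ι K} (hf : f ∈ srIdeal K Δ ^ m)
    {e : ι →₀ ℕ} (he : e ∈ f.support) : m ≤ ∑ i ∈ Fᶜ, e i := by
  let W (m : ℕ) : Ideal (MvPolynomial ι K) :=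
    Ideal.span ((fun e => monomial e (1 : K)) '' {e : ι →₀ ℕ | m ≤ ∑ i ∈ Fᶜ, e i})
  have hmul (a b : ℕ) : W a * W b ≤ W (a + b) := by
    simp only [W]
    rw [Ideal.span_mul_span', Ideal.span_le]
    rintro _ ⟨_, ⟨e, he, rfl⟩, _, ⟨e', he', rfl⟩, rfl⟩
    refine Ideal.subset_span ⟨e + e', ?_, by simp [monomial_mul]⟩
    simp only [Set.mem_ofPred_eq, Finsupp.add_apply, Finset.sum_add_distrib] at *
    omega
  have hone : srIdeal K Δ ≤ W 1 := by
    refine (srIdeal_le_facePrime K hΔ hF).trans ?_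
    rw [facePrime, Ideal.span_le]
    rintro _ ⟨i, hi, rfl⟩
    refine Ideal.subset_span ⟨Finsupp.single i 1, ?_, rfl⟩
    have : i ∈ Fᶜ := Finset.mem_compl.2 hi
    calc 1 = Finsupp.single i 1 i := by simp
      _ ≤ _ := Finset.single_le_sum (f := fun j => Finsupp.single i 1 j) (by simp) this
  have hpow (m : ℕ) : srIdeal K Δ ^ m ≤ W m := by
    induction m with
    | zero =>
      intro f _
      refine mem_ideal_span_monomial_image.2 fun e _ => ⟨e, by simp, le_rfl⟩
    | succ m ih =>
      rw [pow_succ]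
      exact (Ideal.mul_mono ih hone).trans (hmul m 1)
  obtain ⟨e', he', hle⟩ := mem_ideal_span_monomial_image.1 (hpow m hf) e he
  exact le_trans he' (Finset.sum_le_sum fun i _ => hle i)

lemma prod_X_pow_mul_mem_srIdeal_pow {Δ : FaceSet ι} {F : Finset ι} (hF : F ∈ facets Δ)
    (γ : ι →₀ ℕ) :
    (∏ i ∈ F, (X i : MvPolynomial ι K)) ^ (∑ i ∈ Fᶜ, γ i) * monomial γ 1
      ∈ srIdeal K Δ ^ (∑ i ∈ Fᶜ, γ i) := by
  have hmono : (monomial γ (1 : K)) = ∏ i, X i ^ γ i := by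
    rw [monomial_eq, Finsupp.prod_fintype _ _ (by simp)]
    simp
  have hi {i : ι} (h : i ∈ Fᶜ) :
      (∏ j ∈ F, (X j : MvPolynomial ι K)) * X i ∈ srIdeal K Δ := by
    have hiF := Finset.mem_compl.1 h
    refine Ideal.subset_span ⟨insert i F, fun hmem => hiF ?_, ?_⟩
    · rw [hF.2 _ hmem (Finset.subset_insert i F)]
      exact Finset.mem_insert_self i F
    · rw [Finset.prod_insert hiF, mul_comm]
  rw [hmono, ← Finset.prod_mul_prod_compl F, mul_left_comm]
  refine Ideal.mul_mem_left _ _ ?_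
  simp only [← Finset.prod_pow_eq_pow_sum, ← Finset.prod_mul_distrib]
  refine Ideal.prod_mem_prod fun i h => ?_
  rw [← mul_pow]
  exact Ideal.pow_mem_pow (hi h) _

lemma monomial_mem_symbolicPower_iff {Δ : FaceSet ι} (hΔ : IsSimplicialComplex Δ) (m : ℕ)
    (γ : ι →₀ ℕ) :
    monomial γ (1 : K) ∈ symbolicPower (srIdeal K Δ) m ↔
      ∀ F ∈ facets Δ, m ≤ ∑ i ∈ Fᶜ, γ i := by
  have hloc {p : Ideal (MvPolynomial ι K)} (hp : p.IsPrime) :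
      monomial γ (1 : K) ∈ (Ideal.map (algebraMap (MvPolynomial ι K) (Localization.AtPrime p))
        (srIdeal K Δ ^ m)).comap (algebraMap (MvPolynomial ι K) (Localization.AtPrime p)) ↔
      ∃ s ∉ p, s * monomial γ (1 : K) ∈ srIdeal K Δ ^ m := by
    rw [Ideal.mem_comap, IsLocalization.algebraMap_mem_map_algebraMap_iff p.primeCompl]
    rfl
  simp only [symbolicPower, Submodule.mem_iInf]
  constructor
  · intro h F hF
    have hp := (mem_minimalPrimes_srIdeal K hΔ (facePrime K F)).2 ⟨F, hF, rfl⟩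
    obtain ⟨s, hs, hmem⟩ := (hloc hp.1.1).1 (h _ hp)
    rw [facePrime, mem_ideal_span_X_image] at hs
    push Not at hs
    obtain ⟨e, he, he0⟩ := hs
    have hsupp : e + γ ∈ (s * monomial γ (1 : K)).support := by
      rw [mem_support_iff, coeff_mul_monomial, mul_one]
      exact mem_support_iff.1 he
    have := le_sum_compl_of_mem_srIdeal_pow K hΔ hF.1 m hmem hsupp
    rwa [Finset.sum_congr rfl fun i hi => ?_] at this
    simp [he0 i (Finset.mem_compl.1 hi)]
  · intro h p hp
    rw [hloc hp.1.1]
    obtain ⟨F, hF, rfl⟩ := (mem_minimalPrimes_srIdeal K hΔ p).1 hp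
    refine ⟨(∏ i ∈ F, X i) ^ (∑ i ∈ Fᶜ, γ i), fun hmem => ?_, ?_⟩
    · obtain ⟨i, hi, hiP⟩ := (hp.1.1.prod_mem_iff).1 (hp.1.1.mem_of_pow_mem _ hmem)
      exact (X_mem_facePrime K).1 hiP hi
    · exact Ideal.pow_le_pow_right (h F hF) (prod_X_pow_mul_mem_srIdeal_pow K hF γ)

end SymbolicPowers

section DegreeComplexes

variable (K : Type*) [Field K] {ι : Type*} [Fintype ι] [LinearOrder ι]

lemma mem_degreeComplex_symbolicPower_iff {Δ : FaceSet ι} (hΔ : IsSimplicialComplex Δ) (n : ℕ)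
    (α : ι → ℤ) (σ : Finset ι) :
    σ ∈ degreeComplex K (symbolicPower (srIdeal K Δ) n) α ↔
      (∀ i ∈ σ, 0 ≤ α i) ∧
        ∃ H ∈ facets Δ, σ ∪ negSupport α ⊆ H ∧ ∑ i ∈ Hᶜ, (α i).toNat < n := by
  have hmono (m : ℕ) :
      monomial (Finsupp.equivFunOnFinite.symm fun i => (α i).toNat) (1 : K) *
        (∏ i ∈ σ ∪ negSupport α, X i) ^ m =
      monomial (Finsupp.equivFunOnFinite.symm fun i =>
        (α i).toNat + if i ∈ σ ∪ negSupport α then m else 0) (1 : K) := by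
    rw [← Finset.prod_pow, monomial_eq, monomial_eq, Finsupp.prod_fintype _ _ (by simp),
      Finsupp.prod_fintype _ _ (by simp)]
    simp only [Finsupp.equivFunOnFinite_symm_apply_apply, pow_add, Finset.prod_mul_distrib,
      pow_ite, pow_zero, Finset.prod_ite_mem, Finset.univ_inter, map_one, one_mul]
  simp only [degreeComplex, Set.mem_ofPred_eq, hmono, monomial_mem_symbolicPower_iff K hΔ,
    Finsupp.equivFunOnFinite_symm_apply_apply]
  refine and_congr_right fun _ => ?_
  push Not
  constructor
  · intro h
    obtain ⟨H, hH, hlt⟩ := h n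
    have hsub : σ ∪ negSupport α ⊆ H := by
      intro j hj
      by_contra hjH
      have := Finset.single_le_sum
        (f := fun i => (α i).toNat + if i ∈ σ ∪ negSupport α then n else 0)
        (fun _ _ => Nat.zero_le _) (Finset.mem_compl.2 hjH)
      simp only [hj, if_true] at this
      omega
    refine ⟨H, hH, hsub, lt_of_le_of_lt (Finset.sum_le_sum fun i _ => Nat.le_add_right _ _) hlt⟩
  · rintro ⟨H, hH, hsub, hlt⟩ m
    refine ⟨H, hH, ?_⟩
    rwa [Finset.sum_congr rfl fun i hi => ?_]
    rw [if_neg fun h => Finset.mem_compl.1 hi (hsub h), add_zero]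

lemma negSupport_natCast {ι : Type*} [Fintype ι] (α : ι → ℕ) : negSupport (fun i => (α i : ℤ)) = ∅ := by
  simp [negSupport]

lemma mem_degreeComplex_natCast_iff {Δ : FaceSet ι} (hΔ : IsSimplicialComplex Δ) (n : ℕ)
    (α : ι → ℕ) (σ : Finset ι) :
    σ ∈ degreeComplex K (symbolicPower (srIdeal K Δ) n) (fun i => (α i : ℤ)) ↔
      ∃ H ∈ facets Δ, σ ⊆ H ∧ ∑ i ∈ Hᶜ, α i < n := by
  rw [mem_degreeComplex_symbolicPower_iff K hΔ, negSupport_natCast]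
  simp

lemma facet_mem_facets_degreeComplex_iff {Δ : FaceSet ι} (hΔ : IsSimplicialComplex Δ) (n : ℕ)
    (α : ι → ℕ) {H : Finset ι} (hH : H ∈ facets Δ) :
    H ∈ facets (degreeComplex K (symbolicPower (srIdeal K Δ) n) (fun i => (α i : ℤ))) ↔
      ∑ i ∈ Hᶜ, α i < n := by
  constructor
  · intro h
    obtain ⟨H', hH', hsub, hlt⟩ := (mem_degreeComplex_natCast_iff K hΔ n α H).1 h.1
    rwa [hH.2 H' hH'.1 hsub]
  · intro h
    refine ⟨(mem_degreeComplex_natCast_iff K hΔ n α H).2 ⟨H, hH, subset_rfl, h⟩, ?_⟩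
    intro τ hτ hsub
    obtain ⟨H', hH', hsub', -⟩ := (mem_degreeComplex_natCast_iff K hΔ n α τ).1 hτ
    exact hH.2 τ (hΔ H' hH'.1 τ hsub') hsub

end DegreeComplexes

section Homology

variable (K : Type*) [Field K] {ι : Type*} [LinearOrder ι]

lemma bdry_single (σ : Finset ι) :
    bdry K (Finsupp.single σ 1) = ∑ v ∈ σ, ((-1 : K) ^ (σ.filter fun w => w < v).card) •
      Finsupp.single (σ.erase v) (1 : K) := by
  simp [bdry]

/-- The contracting homotopy of a cone with apex `a`. -/
noncomputable def coneHomotopy (a : ι) : (Finset ι →₀ K) →ₗ[K] (Finset ι →₀ K) :=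
  Finsupp.lsum K fun σ => LinearMap.toSpanSingleton K _
    (if a ∈ σ then 0 else
      ((-1 : K) ^ (σ.filter fun w => w < a).card) • Finsupp.single (insert a σ) (1 : K))

lemma coneHomotopy_single (a : ι) (σ : Finset ι) :
    coneHomotopy K a (Finsupp.single σ 1) = if a ∈ σ then 0 else
      ((-1 : K) ^ (σ.filter fun w => w < a).card) • Finsupp.single (insert a σ) (1 : K) := by
  simp [coneHomotopy]

lemma neg_one_pow_insert_erase {a v : ι} {σ : Finset ι} (ha : a ∉ σ) (hv : v ∈ σ) :
    (-1 : K) ^ (σ.filter fun w => w < a).card *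
        (-1 : K) ^ ((insert a σ).filter fun w => w < v).card =
      -((-1 : K) ^ (σ.filter fun w => w < v).card *
        (-1 : K) ^ ((σ.erase v).filter fun w => w < a).card) := by
  have hav : a ≠ v := fun h => ha (h ▸ hv)
  rw [Finset.filter_insert, Finset.filter_erase]
  rcases lt_or_gt_of_ne hav with h | h
  · rw [if_pos h, Finset.card_insert_of_notMem (by simp [ha]),
      Finset.erase_eq_of_notMem (by simp [h.le])]
    ring
  · rw [if_neg h.le.not_gt]
    have : v ∈ σ.filter fun w => w < a := by simp [hv, h]
    rw [← Finset.card_erase_add_one this]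
    ring

lemma bdry_coneHomotopy_add (a : ι) (z : Finset ι →₀ K) :
    bdry K (coneHomotopy K a z) + coneHomotopy K a (bdry K z) = z := by
  suffices h : bdry K ∘ₗ coneHomotopy K a + coneHomotopy K a ∘ₗ bdry K = LinearMap.id from
    DFunLike.congr_fun h z
  refine Finsupp.lhom_ext' fun σ => LinearMap.ext_ring ?_
  simp only [LinearMap.comp_apply, LinearMap.add_apply, Finsupp.lsingle_apply, LinearMap.id_apply,
    bdry_single, map_sum, map_smul, coneHomotopy_single]
  by_cases ha : a ∈ σ
  · rw [if_pos ha, map_zero, zero_add, Finset.sum_eq_single_of_mem a ha]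
    · have : ((σ.erase a).filter fun w => w < a) = σ.filter fun w => w < a := by
        rw [Finset.filter_erase, Finset.erase_eq_of_notMem (by simp)]
      rw [if_neg (Finset.notMem_erase a σ), Finset.insert_erase ha, this, smul_smul,
        ← mul_pow, neg_one_mul, neg_neg, one_pow, one_smul]
    · intro v _ hva
      rw [if_pos (Finset.mem_erase.2 ⟨hva.symm, ha⟩), smul_zero]
  · rw [if_neg ha, map_smul, bdry_single, Finset.sum_insert ha, smul_add, smul_smul,
      Finset.erase_insert ha, Finset.filter_insert, if_neg (lt_irrefl a), ← mul_pow, neg_one_mul,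
      neg_neg, one_pow, one_smul, add_assoc, Finset.smul_sum, ← Finset.sum_add_distrib,
      Finset.sum_eq_zero, add_zero]
    intro v hv
    have hav : a ≠ v := fun h => ha (h ▸ hv)
    rw [if_neg fun h => ha (Finset.mem_of_mem_erase h), smul_smul, smul_smul,
      neg_one_pow_insert_erase K ha hv, Finset.erase_insert_of_ne hav, neg_smul, neg_add_cancel]

lemma not_hasNontrivialReducedHomology_of_cone {Δ : FaceSet ι} (a : ι)
    (h : ∀ σ ∈ Δ, insert a σ ∈ Δ) (j : ℤ) : ¬ HasNontrivialReducedHomology K Δ j := by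
  rintro ⟨d, -, z, hz, hz0, hnot⟩
  refine hnot ⟨coneHomotopy K a z, ?_, ?_⟩
  · suffices hle : cardFaces K Δ d ≤ (cardFaces K Δ (d + 1)).comap (coneHomotopy K a) from hle hz
    rw [cardFaces, Submodule.span_le]
    rintro _ ⟨σ, hσ, hd, rfl⟩
    simp only [Submodule.comap_coe, Set.mem_preimage, SetLike.mem_coe, coneHomotopy_single]
    split_ifs with ha
    · exact Submodule.zero_mem _
    · exact Submodule.smul_mem _ _ (Submodule.subset_span
        ⟨insert a σ, h σ hσ, by rw [Finset.card_insert_of_notMem ha, hd], rfl⟩)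
  · simpa [hz0] using bdry_coneHomotopy_add K a z

lemma HasNontrivialReducedHomology.lt_card [Fintype ι] {Δ : FaceSet ι} {j : ℤ}
    (h : HasNontrivialReducedHomology K Δ j) : j < Fintype.card ι := by
  obtain ⟨d, hd, z, hz, -, hnot⟩ := h
  suffices d ≤ Fintype.card ι by omega
  by_contra! hlt
  have hbot : cardFaces K Δ d = ⊥ := by
    rw [cardFaces, Submodule.span_eq_bot]
    rintro _ ⟨σ, -, hσ, rfl⟩
    exact absurd (Finset.card_le_univ σ) (by omega)
  rw [hbot, Submodule.mem_bot] at hz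
  exact hnot ⟨0, Submodule.zero_mem _, by rw [map_zero, hz]⟩

end Homology

section Regularity

variable (K : Type*) [Field K] {ι : Type*} [Fintype ι] [LinearOrder ι]

lemma lcNonzero.le_of_symbolicPower {Δ : FaceSet ι} (hΔ : IsSimplicialComplex Δ) {n i : ℕ}
    {α : ι → ℤ} (h : lcNonzero K (symbolicPower (srIdeal K Δ) n) i α) (j : ι) :
    α j ≤ n := by
  by_contra! hj
  refine not_hasNontrivialReducedHomology_of_cone K j (fun σ hσ => ?_) _ h
  rw [mem_degreeComplex_symbolicPower_iff K hΔ] at hσ ⊢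
  obtain ⟨hpos, H, hH, hsub, hlt⟩ := hσ
  refine ⟨fun i hi => ?_, H, hH, ?_, hlt⟩
  · rcases Finset.mem_insert.1 hi with rfl | hi
    · omega
    · exact hpos i hi
  · rw [Finset.insert_union, Finset.insert_subset_iff]
    refine ⟨?_, hsub⟩
    by_contra hjH
    have := Finset.single_le_sum (f := fun i => (α i).toNat) (fun _ _ => Nat.zero_le _)
      (Finset.mem_compl.2 hjH)
    omega

lemma lcNonzero.sum_lt_reg {Δ : FaceSet ι} (hΔ : IsSimplicialComplex Δ) {n i : ℕ}
    {α : ι → ℤ} (h : lcNonzero K (symbolicPower (srIdeal K Δ) n) i α) :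
    ∑ j, α j < reg K (symbolicPower (srIdeal K Δ) n) := by
  suffices (∑ j, α j) + i ≤ regQuot K (symbolicPower (srIdeal K Δ) n) by
    rw [reg]
    omega
  refine le_csSup ⟨Fintype.card ι * n + 2 * Fintype.card ι, ?_⟩ ⟨i, α, h, rfl⟩
  rintro _ ⟨k, β, hβ, rfl⟩
  have hk := HasNontrivialReducedHomology.lt_card K hβ
  have hG : (negSupport β).card ≤ Fintype.card ι := Finset.card_le_univ _
  have hsum : ∑ j, β j ≤ Fintype.card ι * (n : ℤ) := by
    simpa using Finset.sum_le_card_nsmul Finset.univ β n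
      fun j _ => lcNonzero.le_of_symbolicPower K hΔ hβ j
  omega

end Regularity

section Main

variable (K : Type*) [Field K]

lemma degreeComplex_natCast_eq {ι : Type*} [Fintype ι] [LinearOrder ι] {Δ : FaceSet ι}
    (hΔ : IsSimplicialComplex Δ) {n m : ℕ} {α β : ι → ℕ}
    (h : ∀ H ∈ facets Δ, ∑ i ∈ Hᶜ, α i < n ↔ ∑ i ∈ Hᶜ, β i < m) :
    degreeComplex K (symbolicPower (srIdeal K Δ) n) (fun i => (α i : ℤ)) =
      degreeComplex K (symbolicPower (srIdeal K Δ) m) (fun i => (β i : ℤ)) := by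
  ext σ
  rw [mem_degreeComplex_natCast_iff K hΔ, mem_degreeComplex_natCast_iff K hΔ]
  exact exists_congr fun H => and_congr_right fun hH => and_congr_right fun _ => h H hH

lemma lcNonzero_natCast_congr {ι : Type*} [Fintype ι] [LinearOrder ι] {Δ : FaceSet ι}
    (hΔ : IsSimplicialComplex Δ) {n m i : ℕ} {α β : ι → ℕ}
    (h : ∀ H ∈ facets Δ, ∑ i ∈ Hᶜ, α i < n ↔ ∑ i ∈ Hᶜ, β i < m)
    (hα : lcNonzero K (symbolicPower (srIdeal K Δ) n) i (fun j => (α j : ℤ))) :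
    lcNonzero K (symbolicPower (srIdeal K Δ) m) i (fun j => (β j : ℤ)) := by
  rw [lcNonzero, negSupport_natCast, degreeComplex_natCast_eq K hΔ h] at hα
  rwa [lcNonzero, negSupport_natCast]

/-- The coordinate sum of a strictly feasible point is bounded by the asymptotic regularity. -/
lemma sum_le_of_strictly_feasible {ι : Type*} [Fintype ι] [LinearOrder ι] {Δ : FaceSet ι}
    (hΔ : IsSimplicialComplex Δ) {n i : ℕ} {α : ι → ℕ}
    (hlc : lcNonzero K (symbolicPower (srIdeal K Δ) n) i (fun j => (α j : ℤ)))
    {y : ι → ℝ} (hy : ∀ j, 0 ≤ y j) {η : ℝ} (hη : 0 < η)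
    (hlt : ∀ H ∈ facets Δ, ∑ j ∈ Hᶜ, α j < n → ∑ j ∈ Hᶜ, y j ≤ 1 - η)
    (hge : ∀ H ∈ facets Δ, n ≤ ∑ j ∈ Hᶜ, α j → 1 + η ≤ ∑ j ∈ Hᶜ, y j) {δ : ℝ}
    (hδ : Tendsto (fun m : ℕ => (reg K (symbolicPower (srIdeal K Δ) m) : ℝ) / m)
      atTop (nhds δ)) :
    ∑ j, y j ≤ δ := by
  set r : ℝ := (Fintype.card ι : ℝ)
  have hlim : Tendsto (fun m : ℕ => (∑ j, y j) - r / m) atTop (nhds (∑ j, y j)) := by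
    simpa using tendsto_const_nhds.sub (tendsto_const_div_atTop_nhds_zero_nat r)
  refine le_of_tendsto_of_tendsto hlim hδ ?_
  obtain ⟨N, hN⟩ := exists_nat_ge (r / η)
  filter_upwards [eventually_ge_atTop N, eventually_gt_atTop 0] with m hmN hm
  have hm0 : (0 : ℝ) < m := Nat.cast_pos.2 hm
  have hrm : r ≤ m * η := (div_le_iff₀ hη).1 (hN.trans (Nat.cast_le.2 hmN))
  have hupper (S : Finset ι) : ((∑ j ∈ S, ⌊m * y j⌋₊ : ℕ) : ℝ) ≤ m * ∑ j ∈ S, y j := by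
    rw [Nat.cast_sum, Finset.mul_sum]
    exact Finset.sum_le_sum fun j _ => Nat.floor_le (mul_nonneg hm0.le (hy j))
  have hlower (S : Finset ι) : m * ∑ j ∈ S, y j - r ≤ ((∑ j ∈ S, ⌊m * y j⌋₊ : ℕ) : ℝ) := by
    have hS : (S.card : ℝ) ≤ r := Nat.cast_le.2 (Finset.card_le_univ S)
    have := Finset.sum_le_sum fun j (_ : j ∈ S) => (Nat.lt_floor_add_one (m * y j)).le
    rw [Finset.sum_add_distrib, ← Finset.mul_sum, Finset.sum_const, nsmul_one] at this
    rw [Nat.cast_sum]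
    linarith
  have hfacet (H) (hH : H ∈ facets Δ) :
      ∑ j ∈ Hᶜ, α j < n ↔ ∑ j ∈ Hᶜ, ⌊m * y j⌋₊ < m := by
    constructor
    · intro h
      have h1 := mul_le_mul_of_nonneg_left (hlt H hH h) hm0.le
      have h2 := mul_pos hm0 hη
      exact_mod_cast (show ((∑ j ∈ Hᶜ, ⌊m * y j⌋₊ : ℕ) : ℝ) < m by linarith [hupper Hᶜ])
    · contrapose!
      intro h
      have h1 := mul_le_mul_of_nonneg_left (hge H hH h) hm0.le
      exact_mod_cast (show (m : ℝ) ≤ ((∑ j ∈ Hᶜ, ⌊m * y j⌋₊ : ℕ) : ℝ) by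
        linarith [hlower Hᶜ])
  have hreg : ((∑ j, ⌊m * y j⌋₊ : ℕ) : ℝ) ≤ reg K (symbolicPower (srIdeal K Δ) m) := by
    exact_mod_cast (lcNonzero.sum_lt_reg K hΔ (lcNonzero_natCast_congr K hΔ hfacet hlc)).le
  rw [le_div_iff₀ hm0, sub_mul, div_mul_cancel₀ _ hm0.ne']
  linarith [hlower Finset.univ]

end Main

/-- In the situation where `Δ` has facets `F_1, …, F_t`, with
`H_𝔪^i(R/I_Δ^{(n)})_α ≠ 0` for some `n ≥ 1`, `i ≥ 0`, `α ∈ ℕ^r`, and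
`F(Δ_α(I_Δ^{(n)})) = {F_1, …, F_s}`: `δ(C_1) ≤ δ(I_Δ)`. -/
theorem statement8 {K : Type*} [Field K] {r t s : ℕ}
    (Δ : FaceSet (Fin r)) (hΔ : IsSimplicialComplex Δ)
    (F : Fin t → Finset (Fin r)) (hFinj : Function.Injective F)
    (hF : facets Δ = Set.range F)
    (n : ℕ) (hn : 1 ≤ n) (i : ℕ) (α : Fin r → ℕ)
    (hlc : lcNonzero K (symbolicPower (srIdeal K Δ) n) i (fun j => (α j : ℤ)))
    (hs : 1 ≤ s) (hst : s ≤ t)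
    (hfac : facets (degreeComplex K (symbolicPower (srIdeal K Δ) n) (fun j => (α j : ℤ)))
      = F '' {j : Fin t | (j : ℕ) < s})
    (δC : ℝ) (hδC : IsGreatest {y : ℝ | ∃ x ∈ polyC F s 1, y = ∑ i, x i} δC)
    (δ : ℝ)
    (hδ : Filter.Tendsto (fun n : ℕ => (reg K (symbolicPower (srIdeal K Δ) n) : ℝ) / n)
      Filter.atTop (nhds δ)) :
    δC ≤ δ := by
  have hfacet (j : Fin t) : ∑ k ∈ (F j)ᶜ, α k < n ↔ (j : ℕ) < s := by
    rw [← facet_mem_facets_degreeComplex_iff K hΔ n α (hF ▸ Set.mem_range_self j), hfac,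
      hFinj.mem_set_image]
    rfl
  obtain ⟨x, ⟨hx0, hx⟩, rfl⟩ := hδC.1
  have hn1 : (1 : ℝ) ≤ n := Nat.one_le_cast.2 hn
  have hn0 : (0 : ℝ) < n - 1 / 2 := by linarith
  have hstep : ∀ᶠ ε in nhdsWithin (0 : ℝ) (Set.Ioi 0), (1 - ε) * ∑ k, x k ≤ δ := by
    filter_upwards [Ioo_mem_nhdsGT (zero_lt_one' ℝ)] with ε ⟨hε0, hε1⟩
    have hsum (S : Finset (Fin r)) :
        ∑ k ∈ S, ((1 - ε) * x k + ε * (α k / (n - 1 / 2))) =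
          (1 - ε) * ∑ k ∈ S, x k + ε * (((∑ k ∈ S, α k : ℕ) : ℝ) / (n - 1 / 2)) := by
      rw [Finset.sum_add_distrib, ← Finset.mul_sum, ← Finset.mul_sum, ← Finset.sum_div,
        Nat.cast_sum]
    have hnn (k : Fin r) : 0 ≤ (1 - ε) * x k + ε * (α k / (n - 1 / 2)) :=
      add_nonneg (mul_nonneg (by linarith) (hx0 k)) (by positivity)
    refine le_trans ?_ (sum_le_of_strictly_feasible K hΔ hlc hnn
      (η := ε * (1 / 2 / (n - 1 / 2))) (by positivity) ?_ ?_ hδ)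
    · rw [hsum]
      exact le_add_of_nonneg_right (by positivity)
    · rw [hF]
      rintro _ ⟨j, rfl⟩ h
      have h1 := mul_le_mul_of_nonneg_left ((hx j).1 ((hfacet j).1 h)) (sub_nonneg.2 hε1.le)
      have h2 : ((∑ k ∈ (F j)ᶜ, α k : ℕ) : ℝ) / (n - 1 / 2) ≤ 1 - 1 / 2 / (n - 1 / 2) := by
        have : ((∑ k ∈ (F j)ᶜ, α k : ℕ) : ℝ) + 1 ≤ n := by exact_mod_cast h
        rw [le_sub_iff_add_le, ← add_div, div_le_one hn0]
        linarith
      have h3 := mul_le_mul_of_nonneg_left h2 hε0.le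
      rw [hsum]
      linarith
    · rw [hF]
      rintro _ ⟨j, rfl⟩ h
      have h1 := mul_le_mul_of_nonneg_left
        ((hx j).2 (not_lt.1 (mt (hfacet j).2 h.not_gt))) (sub_nonneg.2 hε1.le)
      have h2 : 1 + 1 / 2 / (n - 1 / 2) ≤ ((∑ k ∈ (F j)ᶜ, α k : ℕ) : ℝ) / (n - 1 / 2) := by
        have : (n : ℝ) ≤ ((∑ k ∈ (F j)ᶜ, α k : ℕ) : ℝ) := by exact_mod_cast h
        rw [le_div_iff₀ hn0, add_mul, div_mul_cancel₀ _ hn0.ne']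
        linarith
      have h3 := mul_le_mul_of_nonneg_left h2 hε0.le
      rw [hsum]
      linarith
  have hlim : Filter.Tendsto (fun ε : ℝ => (1 - ε) * ∑ k, x k) (nhdsWithin 0 (Set.Ioi 0))
      (nhds (∑ k, x k)) := by
    have : Continuous fun ε : ℝ => (1 - ε) * ∑ k, x k := by fun_prop
    simpa using (this.tendsto 0).mono_left nhdsWithin_le_nhds
  exact le_of_tendsto hlim hstep
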